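/- The additive cut rule is admissible in G4WK: if ⊢_G4WK Γ ⇒ φ and ⊢_G4WK Γ,φ ⇒ Δ then ⊢_G4WK Γ ⇒ Δ. -/

import Mathlib

/-- Formulas of the modal language: φ ::= p | ⊥ | φ∧φ | φ∨φ | φ→φ | □φ | ◇φ. -/
inductive Form : Type
  | var : ℕ → Form
  | bot : Form
  | and : Form → Form → Form
  | or  : Form → Form → Form
  | imp : Form → Form → Form
  | box : Form → Form
  | dia : Form → Form
  deriving DecidableEq

/-- Helper for □⁻¹: remove an outer box. -/
def unboxF : Form → Option Form
  | Form.box φ => some φ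
  | _ => none

/-- □⁻¹Γ := {φ | □φ ∈ Γ}, as a multiset operation. -/
def boxInv (Γ : Multiset Form) : Multiset Form := Γ.filterMap unboxF

/-- ◇⁻¹Δ for a succedent Δ with at most one formula (modelled by `Option`). -/
def diaInv : Option Form → Option Form
  | some (Form.dia φ) => some φ
  | _ => none

/-- Provability in the sequent calculus G4CK: sequents Γ ⇒ δ with a
multiset antecedent and a single-formula succedent. -/
inductive G4CK : Multiset Form → Form → Prop
  | botL (Γ δ) : G4CK (Form.bot ::ₘ Γ) δ
  | idP (Γ n) : G4CK (Form.var n ::ₘ Γ) (Form.var n)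
  | andL (Γ φ ψ δ) : G4CK (φ ::ₘ ψ ::ₘ Γ) δ → G4CK (Form.and φ ψ ::ₘ Γ) δ
  | andR (Γ φ ψ) : G4CK Γ φ → G4CK Γ ψ → G4CK Γ (Form.and φ ψ)
  | orL (Γ φ ψ δ) : G4CK (φ ::ₘ Γ) δ → G4CK (ψ ::ₘ Γ) δ → G4CK (Form.or φ ψ ::ₘ Γ) δ
  | orR1 (Γ φ ψ) : G4CK Γ φ → G4CK Γ (Form.or φ ψ)
  | orR2 (Γ φ ψ) : G4CK Γ ψ → G4CK Γ (Form.or φ ψ)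
  | impR (Γ φ ψ) : G4CK (φ ::ₘ Γ) ψ → G4CK Γ (Form.imp φ ψ)
  | andImpL (Γ φ ψ χ δ) :
      G4CK (Form.imp φ (Form.imp ψ χ) ::ₘ Γ) δ →
      G4CK (Form.imp (Form.and φ ψ) χ ::ₘ Γ) δ
  | orImpL (Γ φ ψ χ δ) :
      G4CK (Form.imp φ χ ::ₘ Form.imp ψ χ ::ₘ Γ) δ →
      G4CK (Form.imp (Form.or φ ψ) χ ::ₘ Γ) δ
  | pImpL (Γ n φ δ) :
      G4CK (Form.var n ::ₘ φ ::ₘ Γ) δ →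
      G4CK (Form.var n ::ₘ Form.imp (Form.var n) φ ::ₘ Γ) δ
  | impImpL (Γ φ ψ χ δ) :
      G4CK (Form.imp ψ χ ::ₘ Γ) (Form.imp φ ψ) → G4CK (χ ::ₘ Γ) δ →
      G4CK (Form.imp (Form.imp φ ψ) χ ::ₘ Γ) δ
  | boxR (Γ φ) : G4CK (boxInv Γ) φ → G4CK Γ (Form.box φ)
  | boxImpL (Γ φ ψ δ) :
      G4CK (boxInv Γ) φ → G4CK (ψ ::ₘ Γ) δ →
      G4CK (Form.imp (Form.box φ) ψ ::ₘ Γ) δ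
  | diaImpL (Γ γ φ ψ δ) :
      G4CK (γ ::ₘ boxInv Γ) φ → G4CK (ψ ::ₘ Form.dia γ ::ₘ Γ) δ →
      G4CK (Form.imp (Form.dia φ) ψ ::ₘ Form.dia γ ::ₘ Γ) δ
  | diaL (Γ φ ψ) : G4CK (φ ::ₘ boxInv Γ) ψ → G4CK (Form.dia φ ::ₘ Γ) (Form.dia ψ)

/-- Provability in the sequent calculus G4WK: sequents Γ ⇒ Δ with a
multiset antecedent and a succedent with at most one formula (`Option Form`). -/
inductive G4WK : Multiset Form → Option Form → Prop
  | botL (Γ Δ) : G4WK (Form.bot ::ₘ Γ) Δ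
  | idP (Γ n) : G4WK (Form.var n ::ₘ Γ) (some (Form.var n))
  | andL (Γ φ ψ Δ) : G4WK (φ ::ₘ ψ ::ₘ Γ) Δ → G4WK (Form.and φ ψ ::ₘ Γ) Δ
  | andR (Γ φ ψ) : G4WK Γ (some φ) → G4WK Γ (some ψ) → G4WK Γ (some (Form.and φ ψ))
  | orL (Γ φ ψ Δ) : G4WK (φ ::ₘ Γ) Δ → G4WK (ψ ::ₘ Γ) Δ → G4WK (Form.or φ ψ ::ₘ Γ) Δ
  | orR1 (Γ φ ψ) : G4WK Γ (some φ) → G4WK Γ (some (Form.or φ ψ))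
  | orR2 (Γ φ ψ) : G4WK Γ (some ψ) → G4WK Γ (some (Form.or φ ψ))
  | impR (Γ φ ψ) : G4WK (φ ::ₘ Γ) (some ψ) → G4WK Γ (some (Form.imp φ ψ))
  | andImpL (Γ φ ψ χ Δ) :
      G4WK (Form.imp φ (Form.imp ψ χ) ::ₘ Γ) Δ →
      G4WK (Form.imp (Form.and φ ψ) χ ::ₘ Γ) Δ
  | orImpL (Γ φ ψ χ Δ) :
      G4WK (Form.imp φ χ ::ₘ Form.imp ψ χ ::ₘ Γ) Δ →
      G4WK (Form.imp (Form.or φ ψ) χ ::ₘ Γ) Δ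
  | pImpL (Γ n φ Δ) :
      G4WK (Form.var n ::ₘ φ ::ₘ Γ) Δ →
      G4WK (Form.var n ::ₘ Form.imp (Form.var n) φ ::ₘ Γ) Δ
  | impImpL (Γ φ ψ χ Δ) :
      G4WK (Form.imp ψ χ ::ₘ Γ) (some (Form.imp φ ψ)) → G4WK (χ ::ₘ Γ) Δ →
      G4WK (Form.imp (Form.imp φ ψ) χ ::ₘ Γ) Δ
  | boxR (Γ φ) : G4WK (boxInv Γ) (some φ) → G4WK Γ (some (Form.box φ))
  | boxImpL (Γ φ ψ Δ) :
      G4WK (boxInv Γ) (some φ) → G4WK (ψ ::ₘ Γ) Δ →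
      G4WK (Form.imp (Form.box φ) ψ ::ₘ Γ) Δ
  | diaImpL (Γ γ φ ψ Δ) :
      G4WK (γ ::ₘ boxInv Γ) (some φ) → G4WK (ψ ::ₘ Form.dia γ ::ₘ Γ) Δ →
      G4WK (Form.imp (Form.dia φ) ψ ::ₘ Form.dia γ ::ₘ Γ) Δ
  | diaL' (Γ φ Δ) : G4WK (φ ::ₘ boxInv Γ) (diaInv Δ) → G4WK (Form.dia φ ::ₘ Γ) Δ

/-- Axiom schemes of the generalised Hilbert calculus CKH:
intuitionistic axioms A1–A9 together with K_□ and K_◇. -/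
inductive CKAx : Form → Prop
  | a1 (φ ψ : Form) : CKAx (φ.imp (ψ.imp φ))
  | a2 (φ ψ χ : Form) : CKAx ((φ.imp (ψ.imp χ)).imp ((φ.imp ψ).imp (φ.imp χ)))
  | a3 (φ ψ : Form) : CKAx (φ.imp (φ.or ψ))
  | a4 (φ ψ : Form) : CKAx (ψ.imp (φ.or ψ))
  | a5 (φ ψ χ : Form) : CKAx ((φ.imp χ).imp ((ψ.imp χ).imp ((φ.or ψ).imp χ)))
  | a6 (φ ψ : Form) : CKAx ((φ.and ψ).imp φ)
  | a7 (φ ψ : Form) : CKAx ((φ.and ψ).imp ψ)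
  | a8 (φ ψ χ : Form) : CKAx ((φ.imp ψ).imp ((φ.imp χ).imp (φ.imp (ψ.and χ))))
  | a9 (φ : Form) : CKAx (Form.bot.imp φ)
  | kbox (φ ψ : Form) : CKAx ((φ.imp ψ).box.imp (φ.box.imp ψ.box))
  | kdia (φ ψ : Form) : CKAx ((φ.imp ψ).box.imp (φ.dia.imp ψ.dia))

/-- Axiom schemes of WKH: those of CKH together with N : ¬◇⊥. -/
inductive WKAx : Form → Prop
  | ck {φ : Form} : CKAx φ → WKAx φ
  | n : WKAx (Form.bot.dia.imp Form.bot)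

/-- Derivability Γ ⊢ φ in the generalised Hilbert calculus CKH. -/
inductive CKH : Set Form → Form → Prop
  | ax {Γ : Set Form} {φ : Form} : CKAx φ → CKH Γ φ
  | el {Γ : Set Form} {φ : Form} : φ ∈ Γ → CKH Γ φ
  | mp {Γ : Set Form} {φ ψ : Form} : CKH Γ φ → CKH Γ (φ.imp ψ) → CKH Γ ψ
  | nec {Γ : Set Form} {φ : Form} : CKH ∅ φ → CKH Γ φ.box

/-- Derivability Γ ⊢ φ in the generalised Hilbert calculus WKH. -/
inductive WKH : Set Form → Form → Prop
  | ax {Γ : Set Form} {φ : Form} : WKAx φ → WKH Γ φ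
  | el {Γ : Set Form} {φ : Form} : φ ∈ Γ → WKH Γ φ
  | mp {Γ : Set Form} {φ ψ : Form} : WKH Γ φ → WKH Γ (φ.imp ψ) → WKH Γ ψ
  | nec {Γ : Set Form} {φ : Form} : WKH ∅ φ → WKH Γ φ.box

/-- The set of propositional variables occurring in a formula. -/
def vars : Form → Set ℕ
  | .var n => {n}
  | .bot => ∅
  | .and φ ψ => vars φ ∪ vars ψ
  | .or φ ψ => vars φ ∪ vars ψ
  | .imp φ ψ => vars φ ∪ vars ψ
  | .box φ => vars φ
  | .dia φ => vars φ

/-- Variables occurring in a multiset of formulas. -/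
def varsM (Γ : Multiset Form) : Set ℕ := {n | ∃ φ ∈ Γ, n ∈ vars φ}

/-- Variables occurring in a succedent with at most one formula. -/
def varsO : Option Form → Set ℕ
  | none => ∅
  | some φ => vars φ

/-!
Cut is obtained semantically: `G4WK` is sound for Kripke models with a preorder and an
arbitrary modal accessibility relation, and complete for them by well-founded induction on
sequents, the countermodels being glued together above and below a cluster of new worlds.
-/

/-- Kripke models for Wijesekera's logic: a preorder, an accessibility relation and a
monotone valuation. -/
structure KModel where
  W : Type
  le : W → W → Prop
  refl : ∀ w, le w w
  trans : ∀ {u v w}, le u v → le v w → le u w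
  R : W → W → Prop
  V : W → ℕ → Prop
  mono : ∀ {v w}, le v w → ∀ n, V v n → V w n

namespace KModel

/-- Forcing of a formula at a world. -/
def force (M : KModel) : Form → M.W → Prop
  | .var n, w => M.V w n
  | .bot, _ => False
  | .and φ ψ, w => M.force φ w ∧ M.force ψ w
  | .or φ ψ, w => M.force φ w ∨ M.force ψ w
  | .imp φ ψ, w => ∀ v, M.le w v → M.force φ v → M.force ψ v
  | .box φ, w => ∀ v, M.le w v → ∀ u, M.R v u → M.force φ u
  | .dia φ, w => ∀ v, M.le w v → ∃ u, M.R v u ∧ M.force φ u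

/-- Forcing of all formulas of an antecedent. -/
def forceAll (M : KModel) (Γ : Multiset Form) (w : M.W) : Prop := ∀ φ ∈ Γ, M.force φ w

/-- Forcing of a succedent, the empty one being forced nowhere. -/
def forceSucc (M : KModel) : Option Form → M.W → Prop
  | none, _ => False
  | some φ, w => M.force φ w

theorem force_mono (M : KModel) {v w : M.W} (h : M.le v w) :
    ∀ φ, M.force φ v → M.force φ w
  | .var n => M.mono h n
  | .bot => id
  | .and φ ψ => And.imp (M.force_mono h φ) (M.force_mono h ψ)
  | .or φ ψ => Or.imp (M.force_mono h φ) (M.force_mono h ψ)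
  | .imp _ _ => fun H u hu => H u (M.trans h hu)
  | .box _ => fun H u hu => H u (M.trans h hu)
  | .dia _ => fun H u hu => H u (M.trans h hu)

theorem forceAll_mono (M : KModel) {v w : M.W} (h : M.le v w) {Γ : Multiset Form}
    (H : M.forceAll Γ v) : M.forceAll Γ w :=
  fun φ hφ => M.force_mono h φ (H φ hφ)

@[simp] theorem forceAll_cons (M : KModel) (φ : Form) (Γ : Multiset Form) (w : M.W) :
    M.forceAll (φ ::ₘ Γ) w ↔ M.force φ w ∧ M.forceAll Γ w := by
  simp [forceAll]

end KModel

theorem mem_boxInv {Γ : Multiset Form} {φ : Form} : φ ∈ boxInv Γ ↔ Form.box φ ∈ Γ := by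
  simp only [boxInv, Multiset.mem_filterMap]
  constructor
  · rintro ⟨ψ, hψ, h⟩
    cases ψ <;> simp_all [unboxF]
  · exact fun h => ⟨_, h, rfl⟩

theorem KModel.forceAll_boxInv (M : KModel) {Γ : Multiset Form} {w v u : M.W}
    (H : M.forceAll Γ w) (hv : M.le w v) (hu : M.R v u) : M.forceAll (boxInv Γ) u :=
  fun _ hφ => H _ (mem_boxInv.1 hφ) v hv u hu

/-- Every provable sequent is valid. -/
theorem G4WK.sound {Γ : Multiset Form} {Δ : Option Form} (h : G4WK Γ Δ) (M : KModel) :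
    ∀ w, M.forceAll Γ w → M.forceSucc Δ w := by
  induction h with
  | botL Γ Δ => intro w hw; exact ((M.forceAll_cons _ _ _).1 hw).1.elim
  | idP Γ n => intro w hw; exact ((M.forceAll_cons _ _ _).1 hw).1
  | andL Γ φ ψ Δ _ ih =>
    intro w hw
    simp only [KModel.forceAll_cons, KModel.force] at hw ih
    exact ih w ⟨hw.1.1, hw.1.2, hw.2⟩
  | andR Γ φ ψ _ _ ih₁ ih₂ => exact fun w hw => ⟨ih₁ w hw, ih₂ w hw⟩
  | orL Γ φ ψ Δ _ _ ih₁ ih₂ =>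
    intro w hw
    simp only [KModel.forceAll_cons, KModel.force] at hw ih₁ ih₂
    exact hw.1.elim (fun h => ih₁ w ⟨h, hw.2⟩) (fun h => ih₂ w ⟨h, hw.2⟩)
  | orR1 Γ φ ψ _ ih => exact fun w hw => Or.inl (ih w hw)
  | orR2 Γ φ ψ _ ih => exact fun w hw => Or.inr (ih w hw)
  | impR Γ φ ψ _ ih =>
    intro w hw v hv hφ
    exact ih v ((M.forceAll_cons _ _ _).2 ⟨hφ, M.forceAll_mono hv hw⟩)
  | andImpL Γ φ ψ χ Δ _ ih =>
    intro w hw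
    simp only [KModel.forceAll_cons, KModel.force] at hw ih
    exact ih w ⟨fun v hv hφ u hu hψ => hw.1 u (M.trans hv hu) ⟨M.force_mono hu _ hφ, hψ⟩, hw.2⟩
  | orImpL Γ φ ψ χ Δ _ ih =>
    intro w hw
    simp only [KModel.forceAll_cons, KModel.force] at hw ih
    exact ih w ⟨fun v hv h => hw.1 v hv (Or.inl h), fun v hv h => hw.1 v hv (Or.inr h), hw.2⟩
  | pImpL Γ n φ Δ _ ih =>
    intro w hw
    simp only [KModel.forceAll_cons] at hw ih
    exact ih w ⟨hw.1, hw.2.1 w (M.refl w) hw.1, hw.2.2⟩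
  | impImpL Γ φ ψ χ Δ _ _ ih₁ ih₂ =>
    intro w hw
    simp only [KModel.forceAll_cons] at hw ih₁ ih₂
    have hψχ : M.force (.imp ψ χ) w := fun v hv hψ =>
      hw.1 v hv fun u hu _ => M.force_mono hu _ hψ
    exact ih₂ w ⟨hw.1 w (M.refl w) (ih₁ w ⟨hψχ, hw.2⟩), hw.2⟩
  | boxR Γ φ _ ih => exact fun w hw v hv u hu => ih u (M.forceAll_boxInv hw hv hu)
  | boxImpL Γ φ ψ Δ _ _ ih₁ ih₂ =>
    intro w hw
    simp only [KModel.forceAll_cons] at hw ih₂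
    exact ih₂ w ⟨hw.1 w (M.refl w) fun v hv u hu => ih₁ u (M.forceAll_boxInv hw.2 hv hu), hw.2⟩
  | diaImpL Γ γ φ ψ Δ _ _ ih₁ ih₂ =>
    intro w hw
    simp only [KModel.forceAll_cons] at hw ih₁ ih₂
    refine ih₂ w ⟨hw.1 w (M.refl w) fun v hv => ?_, hw.2⟩
    obtain ⟨u, hu, hγ⟩ := hw.2.1 v hv
    exact ⟨u, hu, ih₁ u ⟨hγ, M.forceAll_boxInv hw.2.2 hv hu⟩⟩
  | diaL' Γ φ Δ _ ih =>
    intro w hw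
    simp only [KModel.forceAll_cons] at hw ih
    have key : ∀ v, M.le w v → ∃ u, M.R v u ∧ M.forceSucc (diaInv Δ) u := fun v hv => by
      obtain ⟨u, hu, hφ⟩ := hw.1 v hv
      exact ⟨u, hu, ih u ⟨hφ, M.forceAll_boxInv hw.2 hv hu⟩⟩
    rcases Δ with _ | δ
    · obtain ⟨u, -, h⟩ := key w (M.refl w)
      exact h.elim
    · cases δ
      case dia => exact key
      all_goals
        obtain ⟨u, -, h⟩ := key w (M.refl w)
        exact h.elim

/-- The sequent `Γ ⇒ Δ` fails at some world of some model. -/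
def Refutable (Γ : Multiset Form) (Δ : Option Form) : Prop :=
  ∃ (M : KModel) (w : M.W), M.forceAll Γ w ∧ ¬ M.forceSucc Δ w

theorem Refutable.mono {Γ Γ' : Multiset Form} {Δ Δ' : Option Form} (h : Refutable Γ Δ)
    (hΓ : ∀ (M : KModel) w, M.forceAll Γ w → M.forceAll Γ' w)
    (hΔ : ∀ (M : KModel) w, M.forceSucc Δ' w → M.forceSucc Δ w) : Refutable Γ' Δ' :=
  let ⟨M, w, h₁, h₂⟩ := h
  ⟨M, w, hΓ M w h₁, fun h => h₂ (hΔ M w h)⟩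

/-- The refutable sequents. -/
abbrev RefSeq : Type := {s : Multiset Form × Option Form // Refutable s.1 s.2}

namespace RefSeq

/-- A chosen countermodel of a refutable sequent. -/
noncomputable def model (s : RefSeq) : KModel := s.2.choose

/-- A world of the chosen countermodel at which the sequent fails. -/
noncomputable def root (s : RefSeq) : s.model.W := s.2.choose_spec.choose

theorem forceAll_root (s : RefSeq) : s.model.forceAll s.1.1 s.root :=
  s.2.choose_spec.choose_spec.1

theorem not_forceSucc_root (s : RefSeq) : ¬ s.model.forceSucc s.1.2 s.root :=
  s.2.choose_spec.choose_spec.2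

end RefSeq

/-- The sets of countermodels which may serve as the modal successors of a world forcing `Γ`. -/
def Cluster (Γ : Multiset Form) : Type :=
  {S : Set RefSeq // (∀ s ∈ S, s.model.forceAll (boxInv Γ) s.root) ∧
    ∀ γ, Form.dia γ ∈ Γ → ∃ s ∈ S, s.model.force γ s.root}

/-- The order of the glued model: the cluster lies below all countermodels whose root
forces `Γ`. -/
inductive GlueLE (Γ : Multiset Form) :
    Cluster Γ ⊕ (Σ s : RefSeq, s.model.W) → Cluster Γ ⊕ (Σ s : RefSeq, s.model.W) → Prop
  | cluster (S T) : GlueLE Γ (.inl S) (.inl T)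
  | up (S s x) : s.model.forceAll Γ s.root → s.model.le s.root x → GlueLE Γ (.inl S) (.inr ⟨s, x⟩)
  | inner (s x y) : s.model.le x y → GlueLE Γ (.inr ⟨s, x⟩) (.inr ⟨s, y⟩)

/-- Accessibility in the glued model. -/
inductive GlueR (Γ : Multiset Form) :
    Cluster Γ ⊕ (Σ s : RefSeq, s.model.W) → Cluster Γ ⊕ (Σ s : RefSeq, s.model.W) → Prop
  | cluster (S : Cluster Γ) (s) : s ∈ S.1 → GlueR Γ (.inl S) (.inr ⟨s, s.root⟩)
  | inner (s x y) : s.model.R x y → GlueR Γ (.inr ⟨s, x⟩) (.inr ⟨s, y⟩)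

/-- The model consisting of a cluster of new worlds for `Γ` and all chosen countermodels. -/
noncomputable def glue (Γ : Multiset Form) : KModel where
  W := Cluster Γ ⊕ (Σ s : RefSeq, s.model.W)
  le := GlueLE Γ
  refl
    | .inl S => .cluster S S
    | .inr ⟨s, x⟩ => .inner s x x (s.model.refl x)
  trans := by
    intro u v w h₁ h₂
    cases h₁ with
    | cluster S T =>
      cases h₂ with
      | cluster _ U => exact .cluster S U
      | up _ s x h hx => exact .up S s x h hx
    | up S s x h hx =>
      cases h₂ with
      | inner _ _ y hy => exact .up S s y h (s.model.trans hx hy)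
    | inner s x y hy =>
      cases h₂ with
      | inner _ _ z hz => exact .inner s x z (s.model.trans hy hz)
  R := GlueR Γ
  V
    | .inl _, n => Form.var n ∈ Γ
    | .inr ⟨s, x⟩, n => s.model.V x n
  mono := by
    intro v w h n hn
    cases h with
    | cluster => exact hn
    | up S s x h hx => exact s.model.mono hx n (h _ hn)
    | inner s x y hy => exact s.model.mono hy n hn

theorem glue_force_inr (Γ : Multiset Form) (s : RefSeq) (φ : Form) :
    ∀ x : s.model.W, (glue Γ).force φ (.inr ⟨s, x⟩) ↔ s.model.force φ x := by
  induction φ with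
  | var n => exact fun x => Iff.rfl
  | bot => exact fun x => Iff.rfl
  | and φ ψ ih₁ ih₂ => exact fun x => and_congr (ih₁ x) (ih₂ x)
  | or φ ψ ih₁ ih₂ => exact fun x => or_congr (ih₁ x) (ih₂ x)
  | imp φ ψ ih₁ ih₂ =>
    intro x
    constructor
    · exact fun H y hy hφ => (ih₂ y).1 (H _ (.inner s x y hy) ((ih₁ y).2 hφ))
    · rintro H _ (_ | _ | ⟨_, _, y, hy⟩) hφ
      exact (ih₂ y).2 (H y hy ((ih₁ y).1 hφ))
  | box φ ih =>
    intro x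
    constructor
    · exact fun H y hy z hz => (ih z).1 (H _ (.inner s x y hy) _ (.inner s y z hz))
    · rintro H _ (_ | _ | ⟨_, _, y, hy⟩) _ (_ | ⟨_, _, z, hz⟩)
      exact (ih z).2 (H y hy z hz)
  | dia φ ih =>
    intro x
    constructor
    · intro H y hy
      obtain ⟨_, (_ | ⟨_, _, z, hz⟩), hφ⟩ := H _ (.inner s x y hy)
      exact ⟨z, hz, (ih z).1 hφ⟩
    · rintro H _ (_ | _ | ⟨_, _, y, hy⟩)
      obtain ⟨z, hz, hφ⟩ := H y hy
      exact ⟨_, .inner s y z hz, (ih z).2 hφ⟩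

theorem glue_not_force_of_refutable {Γ : Multiset Form} (S : Cluster Γ) {φ : Form}
    (h : Refutable Γ (some φ)) : ¬ (glue Γ).force φ (.inl S) := by
  intro H
  let s : RefSeq := ⟨(Γ, some φ), h⟩
  have hle : (glue Γ).le (.inl S) (.inr ⟨s, s.root⟩) :=
    .up S s s.root s.forceAll_root (s.model.refl _)
  exact s.not_forceSucc_root ((glue_force_inr Γ s φ _).1 ((glue Γ).force_mono hle φ H))

theorem glue_not_force_box {Γ : Multiset Form} {Δ : Option Form} (S : Cluster Γ) {φ : Form}
    (hΔ : ∀ γ, Form.dia γ ∈ Γ → Refutable (γ ::ₘ boxInv Γ) Δ)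
    (h : Refutable (boxInv Γ) (some φ)) : ¬ (glue Γ).force (.box φ) (.inl S) := by
  intro H
  let T : Cluster Γ := ⟨{s | s.model.forceAll (boxInv Γ) s.root}, fun s hs => hs, fun γ hγ => by
    let s : RefSeq := ⟨(γ ::ₘ boxInv Γ, Δ), hΔ γ hγ⟩
    have hs := (s.model.forceAll_cons _ _ _).1 s.forceAll_root
    exact ⟨s, hs.2, hs.1⟩⟩
  let s : RefSeq := ⟨(boxInv Γ, some φ), h⟩
  exact s.not_forceSucc_root
    ((glue_force_inr Γ s φ _).1 (H _ (.cluster S T) _ (.cluster T s s.forceAll_root)))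

/-- The cluster element whose successors all refute `Δ`. -/
def Cluster.ofRefutable {Γ : Multiset Form} {Δ : Option Form}
    (hΔ : ∀ γ, Form.dia γ ∈ Γ → Refutable (γ ::ₘ boxInv Γ) Δ) : Cluster Γ :=
  ⟨{s | s.model.forceAll (boxInv Γ) s.root ∧ ¬ s.model.forceSucc Δ s.root}, fun _ hs => hs.1,
    fun γ hγ => by
      let s : RefSeq := ⟨(γ ::ₘ boxInv Γ, Δ), hΔ γ hγ⟩
      have hs := (s.model.forceAll_cons _ _ _).1 s.forceAll_root
      exact ⟨s, ⟨hs.2, s.not_forceSucc_root⟩, hs.1⟩⟩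

theorem glue_not_force_dia {Γ : Multiset Form} (S : Cluster Γ) {φ : Form}
    (h : ∀ γ, Form.dia γ ∈ Γ → Refutable (γ ::ₘ boxInv Γ) (some φ)) :
    ¬ (glue Γ).force (.dia φ) (.inl S) := by
  intro H
  obtain ⟨_, ⟨_, s, hs⟩ | _, hφ⟩ := H _ (.cluster S (Cluster.ofRefutable h))
  exact hs.2 ((glue_force_inr Γ s φ _).1 hφ)

theorem glue_force_imp {Γ : Multiset Form} {φ ψ : Form} (hmem : φ.imp ψ ∈ Γ)
    (h : ∀ S : Cluster Γ, ¬ (glue Γ).force φ (.inl S)) (S : Cluster Γ) :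
    (glue Γ).force (.imp φ ψ) (.inl S) := by
  rintro _ (⟨_, T⟩ | ⟨_, s, x, hΓ, hx⟩ | _) hφ
  · exact (h T hφ).elim
  · exact (glue_force_inr Γ s ψ x).2 (hΓ _ hmem x hx ((glue_force_inr Γ s φ x).1 hφ))

/-- What the failure of proof search gives for a formula of the antecedent. -/
def Good (Γ : Multiset Form) (Δ : Option Form) : Form → Prop
  | .var _ => True
  | .bot => False
  | .and _ _ => False
  | .or _ _ => False
  | .box _ => True
  | .dia γ => Refutable (γ ::ₘ boxInv Γ) (diaInv Δ)
  | .imp (.var n) _ => Form.var n ∉ Γ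
  | .imp .bot _ => True
  | .imp (.and _ _) _ => False
  | .imp (.or _ _) _ => False
  | .imp (.imp φ ψ) _ => Refutable Γ (some (.imp φ ψ))
  | .imp (.box φ) _ => Refutable (boxInv Γ) (some φ)
  | .imp (.dia φ) _ => ∀ γ, Form.dia γ ∈ Γ → Refutable (γ ::ₘ boxInv Γ) (some φ)

/-- What the failure of proof search gives for the succedent. -/
def GoodSucc (Γ : Multiset Form) : Option Form → Prop
  | none => True
  | some (.var n) => Form.var n ∉ Γ
  | some .bot => True
  | some (.and _ _) => False
  | some (.or φ ψ) => Refutable Γ (some φ) ∧ Refutable Γ (some ψ)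
  | some (.imp _ _) => False
  | some (.box φ) => Refutable (boxInv Γ) (some φ)
  | some (.dia _) => True

theorem glue_force {Γ : Multiset Form} {Δ : Option Form} (h : ∀ φ ∈ Γ, Good Γ Δ φ)
    (S : Cluster Γ) {φ : Form} (hφ : φ ∈ Γ) : (glue Γ).force φ (.inl S) := by
  have hg := h φ hφ
  match φ with
  | .var n => exact hφ
  | .bot => exact hg.elim
  | .and _ _ => exact hg.elim
  | .or _ _ => exact hg.elim
  | .box φ =>
    rintro _ (⟨_, T⟩ | ⟨_, s, x, hΓ, hx⟩ | _) _ (⟨_, t, ht⟩ | ⟨_, _, y, hy⟩)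
    · exact (glue_force_inr Γ t φ _).2 (T.2.1 t ht φ (mem_boxInv.2 hφ))
    · exact (glue_force_inr Γ s φ y).2 (hΓ _ hφ x hx y hy)
  | .dia γ =>
    rintro _ (⟨_, T⟩ | ⟨_, s, x, hΓ, hx⟩ | _)
    · obtain ⟨t, ht, hγ⟩ := T.2.2 γ hφ
      exact ⟨_, .cluster T t ht, (glue_force_inr Γ t γ _).2 hγ⟩
    · obtain ⟨y, hy, hγ⟩ := hΓ _ hφ x hx
      exact ⟨_, .inner s x y hy, (glue_force_inr Γ s γ y).2 hγ⟩
  | .imp (.var n) _ => exact glue_force_imp hφ (fun _ => hg) S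
  | .imp .bot _ => exact glue_force_imp hφ (fun _ => id) S
  | .imp (.and _ _) _ => exact hg.elim
  | .imp (.or _ _) _ => exact hg.elim
  | .imp (.imp _ _) _ => exact glue_force_imp hφ (fun T => glue_not_force_of_refutable T hg) S
  | .imp (.box _) _ =>
    exact glue_force_imp hφ (fun T => glue_not_force_box T (fun γ hγ => h _ hγ) hg) S
  | .imp (.dia _) _ => exact glue_force_imp hφ (fun T => glue_not_force_dia T hg) S

theorem refutable_of_good {Γ : Multiset Form} {Δ : Option Form} (h : ∀ φ ∈ Γ, Good Γ Δ φ)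
    (hs : GoodSucc Γ Δ) : Refutable Γ Δ := by
  have hd : ∀ γ, Form.dia γ ∈ Γ → Refutable (γ ::ₘ boxInv Γ) (diaInv Δ) := fun γ hγ => h _ hγ
  let S := Cluster.ofRefutable hd
  refine ⟨glue Γ, .inl S, fun φ hφ => glue_force h S hφ, ?_⟩
  match Δ with
  | none => exact id
  | some (.var n) => exact hs
  | some .bot => exact id
  | some (.and _ _) => exact hs.elim
  | some (.or φ ψ) =>
    rintro (H | H)
    · exact glue_not_force_of_refutable S hs.1 H
    · exact glue_not_force_of_refutable S hs.2 H
  | some (.imp _ _) => exact hs.elim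
  | some (.box φ) => exact glue_not_force_box S hd hs
  | some (.dia φ) => exact glue_not_force_dia S hd

/-- The weight of a formula, for which the premises of each rule consist of lighter formulas. -/
def weight : Form → ℕ
  | .var _ => 1
  | .bot => 1
  | .and φ ψ => weight φ + weight ψ + 2
  | .or φ ψ => weight φ + weight ψ + 1
  | .imp φ ψ => weight φ + weight ψ + 1
  | .box φ => weight φ + 1
  | .dia φ => weight φ + 1

/-- The cost of a formula: two lighter formulas together cost less than a formula. -/
def cost (φ : Form) : ℕ := 3 ^ weight φ

theorem cost_pos (φ : Form) : 0 < cost φ := Nat.pow_pos (by norm_num)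

theorem three_mul_cost_le {φ ψ : Form} (h : weight φ < weight ψ) : 3 * cost φ ≤ cost ψ := by
  rw [cost, cost, ← pow_succ']
  exact Nat.pow_le_pow_right (by norm_num) h

/-- The cost of an antecedent. -/
def costAll (Γ : Multiset Form) : ℕ := (Γ.map cost).sum

/-- The cost of a succedent. -/
def costSucc : Option Form → ℕ
  | none => 0
  | some φ => cost φ

@[simp] theorem costAll_cons (φ : Form) (Γ : Multiset Form) :
    costAll (φ ::ₘ Γ) = cost φ + costAll Γ := by
  simp [costAll]

theorem costAll_boxInv_le (Γ : Multiset Form) : costAll (boxInv Γ) ≤ costAll Γ := by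
  induction Γ using Multiset.induction with
  | empty => simp [boxInv]
  | cons φ Γ ih =>
    cases φ with
    | box φ =>
      have h : boxInv (φ.box ::ₘ Γ) = φ ::ₘ boxInv Γ := Multiset.filterMap_cons_some _ _ _ rfl
      have := three_mul_cost_le (φ := φ) (ψ := φ.box) (by simp only [weight]; omega)
      rw [h, costAll_cons, costAll_cons]
      omega
    | _ =>
      rw [costAll_cons, boxInv, Multiset.filterMap_cons_none _ _ rfl]
      exact ih.trans (Nat.le_add_left _ _)

theorem costSucc_diaInv_le (Δ : Option Form) : costSucc (diaInv Δ) ≤ costSucc Δ := by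
  rcases Δ with _ | δ
  · exact le_rfl
  · cases δ with
    | dia φ =>
      have := three_mul_cost_le (φ := φ) (ψ := φ.dia) (by simp only [weight]; omega)
      simp only [diaInv, costSucc]
      omega
    | _ => exact Nat.zero_le _

theorem boxInv_cons_imp (φ ψ : Form) (Γ : Multiset Form) :
    boxInv (φ.imp ψ ::ₘ Γ) = boxInv Γ :=
  Multiset.filterMap_cons_none _ _ rfl

theorem boxInv_cons_dia (φ : Form) (Γ : Multiset Form) :
    boxInv (φ.dia ::ₘ Γ) = boxInv Γ :=
  Multiset.filterMap_cons_none _ _ rfl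

/-- If premises of smaller cost are provable or refutable, and the sequent is neither, then
the formulas of the antecedent are good. -/
theorem good_of_search {Γ : Multiset Form} {Δ : Option Form}
    (ih : ∀ Γ' Δ', costAll Γ' + costSucc Δ' < costAll Γ + costSucc Δ →
      G4WK Γ' Δ' ∨ Refutable Γ' Δ')
    (hp : ¬ G4WK Γ Δ) (hr : ¬ Refutable Γ Δ) {φ : Form} (hφ : φ ∈ Γ) : Good Γ Δ φ := by
  have lighter : ∀ Γ', costAll Γ' < costAll Γ →
      (∀ (M : KModel) w, M.forceAll Γ' w → M.forceAll Γ w) → G4WK Γ' Δ := fun Γ' hc hf =>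
    (ih Γ' Δ (by omega)).resolve_right fun h => hr (h.mono hf fun _ _ => id)
  obtain ⟨Γ, rfl⟩ := Multiset.exists_cons_of_mem hφ
  have hc := costAll_boxInv_le Γ
  simp only [costAll_cons] at ih lighter
  match φ with
  | .var n => trivial
  | .box _ => trivial
  | .bot => exact hp (.botL _ _)
  | .and φ ψ =>
    have h₁ := three_mul_cost_le (φ := φ) (ψ := φ.and ψ) (by simp only [weight]; omega)
    have h₂ := three_mul_cost_le (φ := ψ) (ψ := φ.and ψ) (by simp only [weight]; omega)
    have h₃ := cost_pos (φ.and ψ)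
    refine hp (.andL _ _ _ _ (lighter _ (by simp only [costAll_cons]; omega) fun M w => ?_))
    simp only [KModel.forceAll_cons, KModel.force]
    tauto
  | .or φ ψ =>
    have h₁ := three_mul_cost_le (φ := φ) (ψ := φ.or ψ) (by simp only [weight]; omega)
    have h₂ := three_mul_cost_le (φ := ψ) (ψ := φ.or ψ) (by simp only [weight]; omega)
    have h₃ := cost_pos (φ.or ψ)
    refine hp (.orL _ _ _ _ (lighter _ (by simp only [costAll_cons]; omega) fun M w => ?_)
      (lighter _ (by simp only [costAll_cons]; omega) fun M w => ?_)) <;>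
    · simp only [KModel.forceAll_cons, KModel.force]
      tauto
  | .dia γ =>
    have h₁ := three_mul_cost_le (φ := γ) (ψ := γ.dia) (by simp only [weight]; omega)
    have h₂ := cost_pos γ
    have h₃ := costSucc_diaInv_le Δ
    rw [Good, boxInv_cons_dia]
    exact (ih _ _ (by simp only [costAll_cons]; omega)).resolve_left fun h => hp (.diaL' _ _ _ h)
  | .imp (.var n) ψ =>
    intro hn
    obtain ⟨Γ, rfl⟩ := Multiset.exists_cons_of_mem ((Multiset.mem_cons.1 hn).resolve_left nofun)
    have h₁ := three_mul_cost_le (φ := ψ) (ψ := (Form.var n).imp ψ) (by simp only [weight]; omega)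
    have h₂ := cost_pos ψ
    rw [Multiset.cons_swap] at hp
    refine hp (.pImpL _ _ _ _ (lighter _ (by simp only [costAll_cons]; omega) fun M w => ?_))
    simp only [KModel.forceAll_cons]
    exact fun h => ⟨fun v hv _ => M.force_mono hv _ h.2.1, h.1, h.2.2⟩
  | .imp .bot _ => trivial
  | .imp (.and φ ψ) χ =>
    have h₁ := three_mul_cost_le (φ := φ.imp (ψ.imp χ)) (ψ := (φ.and ψ).imp χ)
      (by simp only [weight]; omega)
    have h₂ := cost_pos ((φ.and ψ).imp χ)
    refine hp (.andImpL _ _ _ _ _ (lighter _ (by simp only [costAll_cons]; omega) fun M w => ?_))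
    simp only [KModel.forceAll_cons]
    exact fun h => ⟨fun v hv hφ => h.1 v hv hφ.1 v (M.refl v) hφ.2, h.2⟩
  | .imp (.or φ ψ) χ =>
    have h₁ := three_mul_cost_le (φ := φ.imp χ) (ψ := (φ.or ψ).imp χ) (by simp only [weight]; omega)
    have h₂ := three_mul_cost_le (φ := ψ.imp χ) (ψ := (φ.or ψ).imp χ) (by simp only [weight]; omega)
    have h₃ := cost_pos ((φ.or ψ).imp χ)
    refine hp (.orImpL _ _ _ _ _ (lighter _ (by simp only [costAll_cons]; omega) fun M w => ?_))
    simp only [KModel.forceAll_cons]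
    exact fun h => ⟨fun v hv hφ => hφ.elim (h.1 v hv) (h.2.1 v hv), h.2.2⟩
  | .imp (.imp φ ψ) χ =>
    have h₁ := three_mul_cost_le (φ := φ.imp ψ) (ψ := (φ.imp ψ).imp χ) (by simp only [weight]; omega)
    have h₂ := three_mul_cost_le (φ := ψ.imp χ) (ψ := (φ.imp ψ).imp χ) (by simp only [weight]; omega)
    have h₃ := three_mul_cost_le (φ := χ) (ψ := (φ.imp ψ).imp χ) (by simp only [weight]; omega)
    have h₄ := cost_pos ((φ.imp ψ).imp χ)
    have right : G4WK (χ ::ₘ Γ) Δ := lighter _ (by simp only [costAll_cons]; omega) fun M w => by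
      simp only [KModel.forceAll_cons]
      exact fun h => ⟨fun v hv _ => M.force_mono hv _ h.1, h.2⟩
    obtain ⟨M, w, hw, hn⟩ := (ih (ψ.imp χ ::ₘ Γ) (some (φ.imp ψ))
      (by simp only [costAll_cons, costSucc]; omega)).resolve_left
        fun h => hp (.impImpL _ _ _ _ _ h right)
    simp only [KModel.forceSucc, KModel.force, not_forall] at hn
    obtain ⟨v, hv, hφ, hψ⟩ := hn
    rw [KModel.forceAll_cons] at hw
    refine ⟨M, v, (M.forceAll_cons _ _ _).2 ⟨fun u hu H => ?_, M.forceAll_mono hv hw.2⟩,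
      fun H => hψ (H v (M.refl v) hφ)⟩
    exact hw.1 u (M.trans hv hu) (H u (M.refl u) (M.force_mono hu _ hφ))
  | .imp (.box φ) χ =>
    have h₁ := three_mul_cost_le (φ := φ) (ψ := φ.box.imp χ) (by simp only [weight]; omega)
    have h₂ := three_mul_cost_le (φ := χ) (ψ := φ.box.imp χ) (by simp only [weight]; omega)
    have h₃ := cost_pos (φ.box.imp χ)
    have right : G4WK (χ ::ₘ Γ) Δ := lighter _ (by simp only [costAll_cons]; omega) fun M w => by
      simp only [KModel.forceAll_cons]
      exact fun h => ⟨fun v hv _ => M.force_mono hv _ h.1, h.2⟩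
    rw [Good, boxInv_cons_imp]
    exact (ih _ _ (by simp only [costSucc]; omega)).resolve_left
      fun h => hp (.boxImpL _ _ _ _ h right)
  | .imp (.dia φ) χ =>
    have h₁ := three_mul_cost_le (φ := φ) (ψ := φ.dia.imp χ) (by simp only [weight]; omega)
    have h₂ := three_mul_cost_le (φ := χ) (ψ := φ.dia.imp χ) (by simp only [weight]; omega)
    have h₃ := cost_pos (φ.dia.imp χ)
    have right : G4WK (χ ::ₘ Γ) Δ := lighter _ (by simp only [costAll_cons]; omega) fun M w => by
      simp only [KModel.forceAll_cons]
      exact fun h => ⟨fun v hv _ => M.force_mono hv _ h.1, h.2⟩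
    intro γ hγ
    obtain ⟨Γ, rfl⟩ := Multiset.exists_cons_of_mem ((Multiset.mem_cons.1 hγ).resolve_left nofun)
    have h₄ := three_mul_cost_le (φ := γ) (ψ := γ.dia) (by simp only [weight]; omega)
    rw [boxInv_cons_dia, costAll_cons] at hc
    rw [boxInv_cons_imp, boxInv_cons_dia]
    have h₅ := costAll_boxInv_le Γ
    exact (ih _ _ (by simp only [costAll_cons, costSucc]; omega)).resolve_left
      fun h => hp (.diaImpL _ _ _ _ _ h right)

/-- If premises of smaller cost are provable or refutable, and the sequent is neither, then
the succedent is good. -/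
theorem goodSucc_of_search {Γ : Multiset Form} {Δ : Option Form}
    (ih : ∀ Γ' Δ', costAll Γ' + costSucc Δ' < costAll Γ + costSucc Δ →
      G4WK Γ' Δ' ∨ Refutable Γ' Δ')
    (hp : ¬ G4WK Γ Δ) (hr : ¬ Refutable Γ Δ) : GoodSucc Γ Δ := by
  have hc := costAll_boxInv_le Γ
  match Δ with
  | none => trivial
  | some .bot => trivial
  | some (.dia _) => trivial
  | some (.var n) =>
    intro hn
    obtain ⟨Γ, rfl⟩ := Multiset.exists_cons_of_mem hn
    exact hp (.idP _ _)
  | some (.and φ ψ) =>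
    have h₁ := three_mul_cost_le (φ := φ) (ψ := φ.and ψ) (by simp only [weight]; omega)
    have h₂ := three_mul_cost_le (φ := ψ) (ψ := φ.and ψ) (by simp only [weight]; omega)
    have h₃ := cost_pos (φ.and ψ)
    exact hp (.andR _ _ _
      ((ih _ _ (by simp only [costSucc]; omega)).resolve_right
        fun h => hr (h.mono (fun _ _ => id) fun _ _ => And.left))
      ((ih _ _ (by simp only [costSucc]; omega)).resolve_right
        fun h => hr (h.mono (fun _ _ => id) fun _ _ => And.right)))
  | some (.or φ ψ) =>
    have h₁ := three_mul_cost_le (φ := φ) (ψ := φ.or ψ) (by simp only [weight]; omega)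
    have h₂ := three_mul_cost_le (φ := ψ) (ψ := φ.or ψ) (by simp only [weight]; omega)
    have h₃ := cost_pos (φ.or ψ)
    exact ⟨(ih _ _ (by simp only [costSucc]; omega)).resolve_left fun h => hp (.orR1 _ _ _ h),
      (ih _ _ (by simp only [costSucc]; omega)).resolve_left fun h => hp (.orR2 _ _ _ h)⟩
  | some (.imp φ ψ) =>
    have h₁ := three_mul_cost_le (φ := φ) (ψ := φ.imp ψ) (by simp only [weight]; omega)
    have h₂ := three_mul_cost_le (φ := ψ) (ψ := φ.imp ψ) (by simp only [weight]; omega)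
    have h₃ := cost_pos (φ.imp ψ)
    refine hp (.impR _ _ _ ((ih _ _ (by simp only [costAll_cons, costSucc]; omega)).resolve_right
      fun ⟨M, w, hw, hn⟩ => hr ?_))
    rw [KModel.forceAll_cons] at hw
    exact ⟨M, w, hw.2, fun H => hn (H w (M.refl w) hw.1)⟩
  | some (.box φ) =>
    have h₁ := three_mul_cost_le (φ := φ) (ψ := φ.box) (by simp only [weight]; omega)
    have h₂ := cost_pos φ
    exact (ih _ _ (by simp only [costSucc]; omega)).resolve_left fun h => hp (.boxR _ _ h)

/-- Every sequent is provable or has a countermodel. -/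
theorem provable_or_refutable (Γ : Multiset Form) (Δ : Option Form) :
    G4WK Γ Δ ∨ Refutable Γ Δ := by
  induction hn : costAll Γ + costSucc Δ using Nat.strong_induction_on generalizing Γ Δ with
  | _ n ih =>
    subst hn
    by_contra! h
    have ih' := fun Γ' Δ' hlt => ih _ hlt Γ' Δ' rfl
    exact h.2 (refutable_of_good (fun φ hφ => good_of_search ih' h.1 h.2 hφ)
      (goodSucc_of_search ih' h.1 h.2))

/-- The additive cut rule is admissible in G4WK:
if Γ ⇒ φ and Γ,φ ⇒ Δ are provable then so is Γ ⇒ Δ. -/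
theorem additive_cut_G4WK :
    ∀ (Γ : Multiset Form) (φ : Form) (Δ : Option Form),
      G4WK Γ (some φ) → G4WK (φ ::ₘ Γ) Δ → G4WK Γ Δ := by
  intro Γ φ Δ h₁ h₂
  refine (provable_or_refutable Γ Δ).resolve_right fun ⟨M, w, hw, hn⟩ => hn ?_
  exact h₂.sound M w ((M.forceAll_cons _ _ _).2 ⟨h₁.sound M w hw, hw⟩)
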